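/- arXiv:2304.10915 — 7 statements merged into one kernel-verified Lean document; each statement's English description precedes it below -/
import Mathlib

section
/- Downward closure of lax asynchronous TeamLTL: for every TeamLTL-formula φ and all teams S ⊆ T, if T ⊨ˡ φ then S ⊨ˡ φ. -/
namespace TeamLTL

/-- A trace over atomic propositions `AP` is an infinite sequence of sets of propositions. -/
abbrev Trace (AP : Type) := ℕ → Set AP

/-- `t[i,∞]`, the suffix of a trace. -/
def Trace.suffix {AP : Type} (t : Trace AP) (i : ℕ) : Trace AP := fun j => t (i + j)

/-- A team is a set of traces. -/
abbrev Team (AP : Type) := Set (Trace AP)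

/-- `T[f,∞] = { t[s,∞] : t ∈ T, s ∈ f t }` for `f : T → P(ℕ)⁺`. -/
def Team.update {AP : Type} (T : Team AP) (f : Trace AP → Set ℕ) : Team AP :=
  { s | ∃ t ∈ T, ∃ i ∈ f t, s = Trace.suffix t i }

/-- `f` maps every trace of `T` to a nonempty set of naturals (i.e. `f : T → P(ℕ)⁺`). -/
def properOn {AP : Type} (T : Team AP) (f : Trace AP → Set ℕ) : Prop :=
  ∀ t ∈ T, (f t).Nonempty

/-- `f' < f` on the team `T'`: for all `t ∈ T'`, `min (f' t) ≤ min (f t)` and whenever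
`f t` has a maximum, `f' t` has a maximum which is strictly smaller. -/
def funLT {AP : Type} (T' : Team AP) (f' f : Trace AP → Set ℕ) : Prop :=
  ∀ t ∈ T', sInf (f' t) ≤ sInf (f t) ∧
    ∀ m, IsGreatest (f t) m → ∃ m', IsGreatest (f' t) m' ∧ m' < m

/-- Formulae of TeamLTL, together with the Boolean disjunction `bor` (⊽) and the
Boolean negation `bneg` (∼).  Plain TeamLTL-formulae (= LTL-formulae in negation
normal form) are those satisfying `isLTL` below. -/
inductive Formula (AP : Type) : Type
  | atom  : AP → Formula AP
  | natom : AP → Formula AP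
  | conj  : Formula AP → Formula AP → Formula AP
  | disj  : Formula AP → Formula AP → Formula AP
  | next  : Formula AP → Formula AP
  | glob  : Formula AP → Formula AP
  | untl  : Formula AP → Formula AP → Formula AP
  | bor   : Formula AP → Formula AP → Formula AP
  | bneg  : Formula AP → Formula AP

/-- Lax team semantics `T ⊨ˡ φ`. -/
def laxSat {AP : Type} : Formula AP → Team AP → Prop
  | .atom p, T => ∀ t ∈ T, p ∈ t 0
  | .natom p, T => ∀ t ∈ T, p ∉ t 0
  | .conj φ ψ, T => laxSat φ T ∧ laxSat ψ T
  | .disj φ ψ, T => ∃ T₁ T₂ : Team AP, T = T₁ ∪ T₂ ∧ laxSat φ T₁ ∧ laxSat ψ T₂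
  | .next φ, T => laxSat φ (Team.update T (fun _ => {1}))
  | .glob φ, T => ∀ f, properOn T f → laxSat φ (Team.update T f)
  | .untl φ ψ, T => ∃ f, properOn T f ∧ laxSat ψ (Team.update T f) ∧
      ({t ∈ T | f t ≠ ({0} : Set ℕ)} = ∅ ∨
        ∀ f', properOn {t ∈ T | f t ≠ ({0} : Set ℕ)} f' →
          funLT {t ∈ T | f t ≠ ({0} : Set ℕ)} f' f →
          laxSat φ (Team.update {t ∈ T | f t ≠ ({0} : Set ℕ)} f'))
  | .bor φ ψ, T => laxSat φ T ∨ laxSat ψ T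
  | .bneg φ, T => ¬ laxSat φ T

/-- Classical LTL semantics on a single trace. -/
def traceSat {AP : Type} : Formula AP → Trace AP → Prop
  | .atom p, t => p ∈ t 0
  | .natom p, t => p ∉ t 0
  | .conj φ ψ, t => traceSat φ t ∧ traceSat ψ t
  | .disj φ ψ, t => traceSat φ t ∨ traceSat ψ t
  | .next φ, t => traceSat φ (Trace.suffix t 1)
  | .glob φ, t => ∀ i, traceSat φ (Trace.suffix t i)
  | .untl φ ψ, t => ∃ i, traceSat ψ (Trace.suffix t i) ∧ ∀ j < i, traceSat φ (Trace.suffix t j)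
  | .bor φ ψ, t => traceSat φ t ∨ traceSat ψ t
  | .bneg φ, t => ¬ traceSat φ t

/-- `φ` is a plain LTL-formula (no ⊽ and no ∼). -/
def Formula.isLTL {AP : Type} : Formula AP → Prop
  | .atom _ => True
  | .natom _ => True
  | .conj φ ψ => φ.isLTL ∧ ψ.isLTL
  | .disj φ ψ => φ.isLTL ∧ ψ.isLTL
  | .next φ => φ.isLTL
  | .glob φ => φ.isLTL
  | .untl φ ψ => φ.isLTL ∧ ψ.isLTL
  | .bor _ _ => False
  | .bneg _ => False

/-- `φ` is a TeamLTL(⊽)-formula (no Boolean negation ∼). -/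
def Formula.noBneg {AP : Type} : Formula AP → Prop
  | .atom _ => True
  | .natom _ => True
  | .conj φ ψ => φ.noBneg ∧ ψ.noBneg
  | .disj φ ψ => φ.noBneg ∧ ψ.noBneg
  | .next φ => φ.noBneg
  | .glob φ => φ.noBneg
  | .untl φ ψ => φ.noBneg ∧ ψ.noBneg
  | .bor φ ψ => φ.noBneg ∧ ψ.noBneg
  | .bneg _ => False

/-- `φ` is a TeamLTL(∼)-formula (no Boolean disjunction ⊽). -/
def Formula.noBor {AP : Type} : Formula AP → Prop
  | .atom _ => True
  | .natom _ => True
  | .conj φ ψ => φ.noBor ∧ ψ.noBor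
  | .disj φ ψ => φ.noBor ∧ ψ.noBor
  | .next φ => φ.noBor
  | .glob φ => φ.noBor
  | .untl φ ψ => φ.noBor ∧ ψ.noBor
  | .bor _ _ => False
  | .bneg φ => φ.noBor

/-- Left-flatness: in every subformula `G ψ` and `ψ U θ`, `ψ` is an LTL-formula;
moreover `φ` is a TeamLTL(⊽)-formula (no ∼). -/
def Formula.leftFlat {AP : Type} : Formula AP → Prop
  | .atom _ => True
  | .natom _ => True
  | .conj φ ψ => φ.leftFlat ∧ ψ.leftFlat
  | .disj φ ψ => φ.leftFlat ∧ ψ.leftFlat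
  | .next φ => φ.leftFlat
  | .glob φ => φ.isLTL
  | .untl φ ψ => φ.isLTL ∧ ψ.leftFlat
  | .bor φ ψ => φ.leftFlat ∧ ψ.leftFlat
  | .bneg _ => False

/-- Left-downward closure: in every subformula `G ψ` and `ψ U θ`, `ψ` is a
TeamLTL(⊽)-formula (contains no ∼). -/
def Formula.leftDC {AP : Type} : Formula AP → Prop
  | .atom _ => True
  | .natom _ => True
  | .conj φ ψ => φ.leftDC ∧ ψ.leftDC
  | .disj φ ψ => φ.leftDC ∧ ψ.leftDC
  | .next φ => φ.leftDC
  | .glob φ => φ.noBneg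
  | .untl φ ψ => φ.noBneg ∧ ψ.leftDC
  | .bor φ ψ => φ.leftDC ∧ ψ.leftDC
  | .bneg φ => φ.leftDC

/-- Length (size) of a formula. -/
def Formula.size {AP : Type} : Formula AP → ℕ
  | .atom _ => 1
  | .natom _ => 1
  | .conj φ ψ => φ.size + ψ.size + 1
  | .disj φ ψ => φ.size + ψ.size + 1
  | .next φ => φ.size + 1
  | .glob φ => φ.size + 1
  | .untl φ ψ => φ.size + ψ.size + 1
  | .bor φ ψ => φ.size + ψ.size + 1
  | .bneg φ => φ.size + 1

/-- Number of occurrences of the Boolean disjunction ⊽ in a formula. -/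
def Formula.borCount {AP : Type} : Formula AP → ℕ
  | .atom _ => 0
  | .natom _ => 0
  | .conj φ ψ => φ.borCount + ψ.borCount
  | .disj φ ψ => φ.borCount + ψ.borCount
  | .next φ => φ.borCount
  | .glob φ => φ.borCount
  | .untl φ ψ => φ.borCount + ψ.borCount
  | .bor φ ψ => φ.borCount + ψ.borCount + 1
  | .bneg φ => φ.borCount

/-- Boolean disjunction `⊽` of a nonempty list of formulae (head plus tail). -/
def disjOf {AP : Type} : Formula AP → List (Formula AP) → Formula AP
  | a, [] => a
  | a, b :: l => .bor a (disjOf b l)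

/-- Conjunction `a ∧ ⋀ l` of a formula with a (possibly empty) list of formulae. -/
def conjAnd {AP : Type} (a : Formula AP) : List (Formula AP) → Formula AP
  | [] => a
  | b :: l => .conj (conjAnd a l) b

/-- Some atomic proposition occurring in a formula. -/
def Formula.someAtom {AP : Type} : Formula AP → AP
  | .atom p => p
  | .natom p => p
  | .conj φ _ => φ.someAtom
  | .disj φ _ => φ.someAtom
  | .next φ => φ.someAtom
  | .glob φ => φ.someAtom
  | .untl φ _ => φ.someAtom
  | .bor φ _ => φ.someAtom
  | .bneg φ => φ.someAtom

/-- The dual `φ^d`: the negation normal form of `¬φ` (for LTL-formulae `φ`).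
`¬Gφ` is rewritten as `⊤ U ¬φ` and `¬(φUψ)` as `(¬ψ U (¬φ ∧ ¬ψ)) ∨ G¬ψ`. -/
def Formula.dual {AP : Type} : Formula AP → Formula AP
  | .atom p => .natom p
  | .natom p => .atom p
  | .conj φ ψ => .disj φ.dual ψ.dual
  | .disj φ ψ => .conj φ.dual ψ.dual
  | .next φ => .next φ.dual
  | .glob φ => .untl (.disj (.atom φ.someAtom) (.natom φ.someAtom)) φ.dual
  | .untl φ ψ => .disj (.untl ψ.dual (.conj φ.dual ψ.dual)) (.glob ψ.dual)
  | .bor φ ψ => .conj φ.dual ψ.dual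
  | .bneg φ => φ

/-- `∃β`, an abbreviation for `∼β^d`: it holds in a team `T` iff some trace of `T`
satisfies `β` classically. -/
def Formula.exi {AP : Type} (β : Formula AP) : Formula AP := .bneg β.dual

end TeamLTL

namespace TeamLTL

theorem Team.update_mono {AP : Type} {S T : Team AP} {f g : Trace AP → Set ℕ} (hST : S ⊆ T)
    (hfg : ∀ t ∈ S, f t ⊆ g t) : Team.update S f ⊆ Team.update T g := by
  rintro _ ⟨t, ht, i, hi, rfl⟩
  exact ⟨t, hST ht, i, hfg t ht hi, rfl⟩

/-- A function `f' < f` on a subteam extends, by the value `{0}`, to a larger team on which `f`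
never takes the value `{0}`. -/
theorem exists_extension_funLT {AP : Type} {S T : Team AP} {f f' : Trace AP → Set ℕ}
    (hf : properOn T f) (hf0 : ∀ t ∈ T, f t ≠ {0}) (hf' : properOn S f') (hlt : funLT S f' f) :
    ∃ g, properOn T g ∧ funLT T g f ∧ ∀ t ∈ S, g t = f' t := by
  classical
  refine ⟨fun t => if t ∈ S then f' t else {0}, fun t _ => ?_, fun t ht => ?_,
    fun t ht => if_pos ht⟩
  · by_cases h : t ∈ S
    · simpa [h] using hf' t h
    · simp [h]
  · by_cases h : t ∈ S
    · simpa only [if_pos h] using hlt t h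
    · simp only [if_neg h, csInf_singleton]
      refine ⟨Nat.zero_le _, fun m hm => ⟨0, isGreatest_singleton, Nat.pos_of_ne_zero ?_⟩⟩
      rintro rfl
      exact hf0 t ht ((hf t ht).subset_singleton_iff.mp fun i hi => Nat.le_zero.mp (hm.2 hi))

/-- **Downward closure** of lax asynchronous TeamLTL: for every TeamLTL-formula `φ`
and teams `S ⊆ T`, if `T ⊨ˡ φ` then `S ⊨ˡ φ`. -/
theorem downward_closure_of_lax_TeamLTL {AP : Type} (φ : Formula AP) (hφ : φ.isLTL)
    (S T : Team AP) (hST : S ⊆ T) (hT : laxSat φ T) :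
    laxSat φ S := by
  induction φ generalizing S T with
  | atom p => exact fun t ht => hT t (hST ht)
  | natom p => exact fun t ht => hT t (hST ht)
  | conj φ ψ ihφ ihψ => exact ⟨ihφ hφ.1 S T hST hT.1, ihψ hφ.2 S T hST hT.2⟩
  | disj φ ψ ihφ ihψ =>
    obtain ⟨T₁, T₂, rfl, h₁, h₂⟩ := hT
    refine ⟨S ∩ T₁, S ∩ T₂, ?_, ihφ hφ.1 _ _ Set.inter_subset_right h₁,
      ihψ hφ.2 _ _ Set.inter_subset_right h₂⟩
    rw [← Set.inter_union_distrib_left, Set.inter_eq_left.mpr hST]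
  | next φ ih => exact ih hφ _ _ (Team.update_mono hST fun _ _ => subset_rfl) hT
  | glob φ ih =>
    intro f hf
    obtain ⟨g, hg, hgf⟩ : ∃ g, properOn T g ∧ ∀ t ∈ S, f t ⊆ g t :=
      ⟨fun t => f t ∪ {0}, fun t _ => ⟨0, Or.inr rfl⟩, fun t _ => Set.subset_union_left⟩
    exact ih hφ _ _ (Team.update_mono hST hgf) (hT g hg)
  | untl φ ψ ihφ ihψ =>
    obtain ⟨f, hf, hψ, h⟩ := hT
    have hsub : {t ∈ S | f t ≠ {0}} ⊆ {t ∈ T | f t ≠ {0}} := fun t ht => ⟨hST ht.1, ht.2⟩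
    refine ⟨f, fun t ht => hf t (hST ht),
      ihψ hφ.2 _ _ (Team.update_mono hST fun _ _ => subset_rfl) hψ, ?_⟩
    refine h.imp (fun h => Set.subset_eq_empty hsub h) fun h f' hf' hlt => ?_
    obtain ⟨g, hg, hgf, hgf'⟩ :=
      exists_extension_funLT (T := {t ∈ T | f t ≠ {0}}) (fun t ht => hf t ht.1)
        (fun _ ht => ht.2) hf' hlt
    exact ihφ hφ.1 _ _ (Team.update_mono hsub fun t ht => (hgf' t ht).ge) (h g hg hgf)
  | bor => exact hφ.elim
  | bneg => exact hφ.elim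

end TeamLTL
end

section
/- Singleton equivalence of lax asynchronous TeamLTL: for every TeamLTL-formula φ and every trace t, the singleton team {t} satisfies φ under lax team semantics if and only if t satisfies φ under classical LTL semantics. -/
namespace TeamLTL

/-- A property holds on all of `T[f,∞]` iff it holds of every suffix selected by `f`. -/
theorem forall_mem_update {AP : Type} {T : Team AP} {f : Trace AP → Set ℕ}
    {P : Trace AP → Prop} :
    (∀ s ∈ Team.update T f, P s) ↔ ∀ t ∈ T, ∀ i ∈ f t, P (Trace.suffix t i) := by
  constructor
  · exact fun h t ht i hi => h _ ⟨t, ht, i, hi, rfl⟩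
  · rintro h s ⟨t, ht, i, hi, rfl⟩
    exact h t ht i hi

/-- The pointwise strict lower closure of `f` is below `f` on the traces where it is nonempty. -/
theorem funLT_strictLower {AP : Type} {T : Team AP} {f : Trace AP → Set ℕ}
    (h : properOn T fun t => {j | ∃ m ∈ f t, j < m}) :
    funLT T (fun t => {j | ∃ m ∈ f t, j < m}) f := by
  intro t ht
  obtain ⟨j, m, hm, hjm⟩ := h t ht
  refine ⟨?_, fun M hM => ?_⟩
  · have h0 : 0 ∈ {j | ∃ m ∈ f t, j < m} := ⟨m, hm, by omega⟩
    exact (Nat.sInf_le h0).trans (Nat.zero_le _)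
  · have hmM : m ≤ M := hM.2 hm
    refine ⟨M - 1, ⟨⟨M, hM.1, by omega⟩, ?_⟩, by omega⟩
    rintro k ⟨n, hn, hkn⟩
    have hnM : n ≤ M := hM.2 hn
    omega

/-- **Flatness**: a team satisfies an LTL-formula under lax semantics iff each of its traces
satisfies it classically. -/
theorem laxSat_iff_forall_traceSat {AP : Type} (φ : Formula AP) (hφ : φ.isLTL) (T : Team AP) :
    laxSat φ T ↔ ∀ t ∈ T, traceSat φ t := by
  induction φ generalizing T with
  | atom p => rfl
  | natom p => rfl
  | conj φ ψ ihφ ihψ =>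
    simp only [laxSat, traceSat, ihφ hφ.1, ihψ hφ.2]
    exact ⟨fun h t ht => ⟨h.1 t ht, h.2 t ht⟩,
      fun h => ⟨fun t ht => (h t ht).1, fun t ht => (h t ht).2⟩⟩
  | disj φ ψ ihφ ihψ =>
    simp only [laxSat, traceSat, ihφ hφ.1, ihψ hφ.2]
    constructor
    · rintro ⟨T₁, T₂, rfl, h₁, h₂⟩ t ht
      exact ht.imp (h₁ t) (h₂ t)
    · intro h
      refine ⟨{t ∈ T | traceSat φ t}, {t ∈ T | traceSat ψ t}, ?_, fun t ht => ht.2,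
        fun t ht => ht.2⟩
      ext t
      exact ⟨fun ht => (h t ht).imp (⟨ht, ·⟩) (⟨ht, ·⟩), fun ht => ht.elim (·.1) (·.1)⟩
  | next φ ih =>
    simp only [laxSat, traceSat, ih hφ, forall_mem_update, Set.mem_singleton_iff, forall_eq]
  | glob φ ih =>
    simp only [laxSat, traceSat, ih hφ, forall_mem_update]
    exact ⟨fun h t ht i => h (fun _ => {i}) (fun _ _ => Set.singleton_nonempty i) t ht i rfl,
      fun h f _ t ht i _ => h t ht i⟩
  | untl φ ψ ihφ ihψ =>
    simp only [laxSat, traceSat, ihφ hφ.1, ihψ hφ.2, forall_mem_update]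
    constructor
    · rintro ⟨f, hf, hψ, hφ'⟩ t ht
      obtain ⟨i, hi⟩ := hf t ht
      refine ⟨i, hψ t ht i hi, fun j hj => ?_⟩
      have htf : t ∈ {t ∈ T | f t ≠ ({0} : Set ℕ)} := by
        refine ⟨ht, fun h0 => ?_⟩
        rw [h0, Set.mem_singleton_iff] at hi
        omega
      rcases hφ' with hempty | hall
      · exact absurd htf (hempty ▸ Set.notMem_empty t)
      · have hne : properOn {t ∈ T | f t ≠ ({0} : Set ℕ)} fun t => {j | ∃ m ∈ f t, j < m} := by
          rintro s ⟨hs, hs0⟩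
          by_contra hcon
          refine hs0 ((hf s hs).subset_singleton_iff.1 fun m hm => ?_)
          by_contra hm0
          exact hcon ⟨0, m, hm, Nat.pos_of_ne_zero hm0⟩
        exact hall _ hne (funLT_strictLower hne) t htf j ⟨i, hi, hj⟩
    · intro h
      choose! g hψ hφ' using h
      refine ⟨fun t => {g t}, fun _ _ => Set.singleton_nonempty _, ?_, Or.inr ?_⟩
      · rintro t ht i rfl
        exact hψ t ht
      · intro f' _ hlt t ht j hj
        obtain ⟨m, hm, hmg⟩ := (hlt t ht).2 (g t) isGreatest_singleton
        exact hφ' t ht.1 j ((hm.2 hj).trans_lt hmg)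
  | bor _ _ _ _ => exact hφ.elim
  | bneg _ _ => exact hφ.elim

/-- **Singleton equivalence** of lax asynchronous TeamLTL: a singleton team `{t}`
satisfies a TeamLTL-formula under lax team semantics iff the trace `t` satisfies it
under classical LTL semantics. -/
theorem singleton_equivalence_of_lax_TeamLTL {AP : Type} (φ : Formula AP)
    (hφ : φ.isLTL) (t : Trace AP) :
    laxSat φ ({t} : Team AP) ↔ traceSat φ t := by
  simp [laxSat_iff_forall_traceSat φ hφ]

end TeamLTL
end

section
/- Flatness of lax asynchronous TeamLTL: for every TeamLTL-formula φ and every team T, T ⊨ˡ φ if and only if {t} ⊨ˡ φ for every t ∈ T. -/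
namespace TeamLTL

/-- **Flatness** of lax asynchronous TeamLTL: `T ⊨ˡ φ` iff `{t} ⊨ˡ φ` for every
trace `t ∈ T`. -/
theorem flatness_of_lax_TeamLTL {AP : Type} (φ : Formula AP) (hφ : φ.isLTL)
    (T : Team AP) :
    laxSat φ T ↔ ∀ t ∈ T, laxSat φ ({t} : Team AP) := by
  simp only [laxSat_iff_forall_traceSat φ hφ, Set.mem_singleton_iff, forall_eq]

end TeamLTL
end

section
/- Strict and lax asynchronous semantics differ, and multiplicities matter for strict semantics: let p, q be distinct atomic propositions and t the trace with t[0] = {p} and t[i] = {q} for all i ≥ 1. Then: (a) the singleton multiteam {(1,t)} satisfies G(p ⊽ q) under strict asynchronous team semantics; (b) the team {t} does not satisfy G(p ⊽ q) under lax team semantics; (c) the two-copy multiteam {(1,t),(2,t)} does not satisfy G(p ⊽ q) under strict asynchronous team semantics. -/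
namespace TeamLTL

/-- A multiteam is a set of index–trace pairs. -/
abbrev MultiTeam (ι : Type) (AP : Type) := Set (ι × Trace AP)

/-- `T[f,∞] = { (i, t[f(i,t),∞]) : (i,t) ∈ T }` for `f : T → ℕ`. -/
def MultiTeam.update {ι AP : Type} (T : MultiTeam ι AP) (f : ι × Trace AP → ℕ) :
    MultiTeam ι AP :=
  { x | ∃ y ∈ T, x = (y.1, Trace.suffix y.2 (f y)) }

/-- The support of a multiteam: the set of traces occurring in it. -/
def MultiTeam.support {ι AP : Type} (T : MultiTeam ι AP) : Team AP :=
  { t | ∃ i, (i, t) ∈ T }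

/-- Strict asynchronous team semantics `T ⊨ φ` on multiteams. -/
def strictSat {ι AP : Type} : Formula AP → MultiTeam ι AP → Prop
  | .atom p, T => ∀ x ∈ T, p ∈ x.2 0
  | .natom p, T => ∀ x ∈ T, p ∉ x.2 0
  | .conj φ ψ, T => strictSat φ T ∧ strictSat ψ T
  | .disj φ ψ, T => ∃ T₁ T₂ : MultiTeam ι AP,
      T = T₁ ∪ T₂ ∧ T₁ ∩ T₂ = ∅ ∧ strictSat φ T₁ ∧ strictSat ψ T₂
  | .next φ, T => strictSat φ (MultiTeam.update T (fun _ => 1))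
  | .glob φ, T => ∀ f, strictSat φ (MultiTeam.update T f)
  | .untl φ ψ, T => ∃ f, strictSat ψ (MultiTeam.update T f) ∧
      ∀ f', (∀ x ∈ {x ∈ T | f x ≠ 0}, f' x < f x) →
        strictSat φ (MultiTeam.update {x ∈ T | f x ≠ 0} f')
  | .bor φ ψ, T => strictSat φ T ∨ strictSat ψ T
  | .bneg φ, T => ¬ strictSat φ T

end TeamLTL

namespace TeamLTL

/-- Strict and lax asynchronous semantics differ, and multiplicities matter for
strict semantics: for the trace `t = {p}{q}{q}…`, (a) the singleton multiteam
`{(1,t)}` satisfies `G(p ⊽ q)` strictly, (b) the team `{t}` does not satisfy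
`G(p ⊽ q)` under lax semantics, and (c) the two-copy multiteam `{(1,t),(2,t)}`
does not satisfy `G(p ⊽ q)` strictly. -/
theorem strict_and_lax_differ {AP : Type} (p q : AP) (hpq : p ≠ q)
    (t : Trace AP) (ht0 : t 0 = {p}) (ht : ∀ i, 1 ≤ i → t i = {q}) :
    strictSat (Formula.glob (.bor (.atom p) (.atom q)))
        ({((1 : ℕ), t)} : MultiTeam ℕ AP) ∧
    ¬ laxSat (Formula.glob (.bor (.atom p) (.atom q))) ({t} : Team AP) ∧
    ¬ strictSat (Formula.glob (.bor (.atom p) (.atom q)))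
        ({((1 : ℕ), t), ((2 : ℕ), t)} : MultiTeam ℕ AP) := by
  refine ⟨fun f => ?_, fun h => ?_, fun h => ?_⟩
  · rcases Nat.eq_zero_or_pos (f (1, t)) with hf | hf
    · left
      rintro x ⟨y, rfl, rfl⟩
      simp [Trace.suffix, hf, ht0]
    · right
      rintro x ⟨y, rfl, rfl⟩
      simp [Trace.suffix, ht _ hf]
  · have hp : properOn ({t} : Team AP) (fun _ => {0, 1}) := fun _ _ => ⟨0, by simp⟩
    rcases h _ hp with h | h
    · have h1 := h _ ⟨t, rfl, 1, by simp, rfl⟩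
      simp [Trace.suffix, ht 1 le_rfl, hpq] at h1
    · have h0 := h _ ⟨t, rfl, 0, by simp, rfl⟩
      simp [Trace.suffix, ht0, hpq.symm] at h0
  · rcases h (fun x => x.1 - 1) with h | h
    · have h2 := h _ ⟨(2, t), by simp, rfl⟩
      simp [Trace.suffix, ht 1 le_rfl, hpq] at h2
    · have h1 := h _ ⟨(1, t), by simp, rfl⟩
      simp [Trace.suffix, ht0, hpq.symm] at h1

end TeamLTL
end

section
/- TeamLTL^l(⊽) is not flat: let p, q be distinct atomic propositions, s₁ the trace with s₁[i] = {p} for all i, and s₂ the trace with s₂[i] = {q} for all i. Then {s₁} ⊨ˡ G(p ⊽ q) and {s₂} ⊨ˡ G(p ⊽ q), but {s₁, s₂} ⊭ˡ G(p ⊽ q). -/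
namespace TeamLTL

/-- TeamLTL^l(⊽) is not flat: with `s₁ = {p}^ω` and `s₂ = {q}^ω`, both singletons
satisfy `G(p ⊽ q)` under lax semantics, but `{s₁, s₂}` does not. -/
theorem lax_TeamLTL_bor_not_flat {AP : Type} (p q : AP) (hpq : p ≠ q)
    (s₁ s₂ : Trace AP) (hs₁ : ∀ i, s₁ i = {p}) (hs₂ : ∀ i, s₂ i = {q}) :
    laxSat (Formula.glob (.bor (.atom p) (.atom q))) ({s₁} : Team AP) ∧
    laxSat (Formula.glob (.bor (.atom p) (.atom q))) ({s₂} : Team AP) ∧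
    ¬ laxSat (Formula.glob (.bor (.atom p) (.atom q))) ({s₁, s₂} : Team AP) := by
  simp only [laxSat]
  refine ⟨fun f _ => Or.inl ?_, fun f _ => Or.inr ?_, fun h => ?_⟩
  · rintro _ ⟨t, rfl, i, _, rfl⟩
    simp [Trace.suffix, hs₁]
  · rintro _ ⟨t, rfl, i, _, rfl⟩
    simp [Trace.suffix, hs₂]
  · rcases h (fun _ => {0}) (fun _ _ => Set.singleton_nonempty 0) with h | h
    · have hp := h (s₂.suffix 0) ⟨s₂, Or.inr rfl, 0, rfl, rfl⟩
      simp only [Trace.suffix, hs₂, Set.mem_singleton_iff] at hp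
      exact hpq hp
    · have hq := h (s₁.suffix 0) ⟨s₁, Or.inl rfl, 0, rfl, rfl⟩
      simp only [Trace.suffix, hs₁, Set.mem_singleton_iff] at hq
      exact hpq hq.symm

end TeamLTL
end

section
/- Strict and lax semantics agree on left-flat formulae: let φ be a left-flat TeamLTL(⊽)-formula. Then for every multiteam T, T ⊨ φ under strict asynchronous team semantics if and only if support(T) ⊨ˡ φ under lax team semantics. -/
namespace TeamLTL

section Flatness

variable {ι AP : Type}

theorem laxSat_untl_iff {φ ψ : Formula AP}
    (hφ : ∀ T : Team AP, laxSat φ T ↔ ∀ t ∈ T, traceSat φ t) (T : Team AP) :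
    laxSat (.untl φ ψ) T ↔ ∃ f, properOn T f ∧ laxSat ψ (T.update f) ∧
      ∀ t ∈ T, ∀ n ∈ f t, ∀ j < n, traceSat φ (t.suffix j) := by
  classical
  simp only [laxSat, hφ]
  refine exists_congr fun f => and_congr_right fun hf => and_congr_right fun _ => ?_
  constructor
  · rintro h t ht n hn j hj
    have ht' : t ∈ {t ∈ T | f t ≠ ({0} : Set ℕ)} := by
      refine ⟨ht, fun h0 => ?_⟩
      rw [h0, Set.mem_singleton_iff] at hn
      omega
    rcases h with h | h
    · exact absurd ht' (h ▸ Set.notMem_empty t)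
    · refine h (fun s => if s = t then {0, j} else {0}) ?_ ?_ _ ⟨t, ht', j, by simp, rfl⟩
      · intro s _
        dsimp only
        split_ifs <;> simp
      · intro s hs
        have h0 : 0 ∈ (if s = t then {0, j} else {0} : Set ℕ) := by split_ifs <;> simp
        refine ⟨(Nat.sInf_le h0).trans (Nat.zero_le _), fun m hm => ?_⟩
        by_cases hst : s = t
        · subst hst
          refine ⟨j, ⟨by simp, fun k hk => ?_⟩, hj.trans_le (hm.2 hn)⟩
          simp only [if_true, Set.mem_insert_iff, Set.mem_singleton_iff] at hk
          omega
        · refine ⟨0, by simp [hst], Nat.pos_of_ne_zero fun hm0 => hs.2 ?_⟩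
          subst hm0
          exact Set.eq_singleton_iff_unique_mem.2
            ⟨hm.1, fun k hk => Nat.le_zero.1 (hm.2 hk)⟩
  · rintro h
    right
    rintro f' - hlt _ ⟨t, ht, j, hj, rfl⟩
    by_cases hb : BddAbove (f t)
    · obtain ⟨m', hm', hlt'⟩ := (hlt t ht).2 _
        ⟨Nat.sSup_mem (hf t ht.1) hb, fun _ hk => le_csSup hb hk⟩
      exact h t ht.1 _ (Nat.sSup_mem (hf t ht.1) hb) j ((hm'.2 hj).trans_lt hlt')
    · obtain ⟨n, hn, hjn⟩ := not_bddAbove_iff.1 hb j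
      exact h t ht.1 n hn j hjn

theorem strictSat_untl_iff {φ ψ : Formula AP}
    (hφ : ∀ T : MultiTeam ι AP, strictSat φ T ↔ ∀ x ∈ T, traceSat φ x.2)
    (T : MultiTeam ι AP) :
    strictSat (.untl φ ψ) T ↔ ∃ f, strictSat ψ (T.update f) ∧
      ∀ x ∈ T, ∀ j < f x, traceSat φ (x.2.suffix j) := by
  classical
  simp only [strictSat, hφ]
  refine exists_congr fun f => and_congr_right fun _ => ?_
  constructor
  · intro h x hx j hj
    have := h (fun y => if y = x then j else 0) ?_ _ ⟨x, ⟨hx, by omega⟩, rfl⟩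
    · simpa using this
    · intro y hy
      split_ifs with hyx
      · exact hyx ▸ hj
      · exact Nat.pos_of_ne_zero hy.2
  · rintro h f' hlt _ ⟨x, hx, rfl⟩
    exact h x hx.1 _ (hlt x hx)

/-- LTL-formulae are flat under lax team semantics. -/
theorem laxSat_iff_of_isLTL (φ : Formula AP) (hφ : φ.isLTL) (T : Team AP) :
    laxSat φ T ↔ ∀ t ∈ T, traceSat φ t := by
  induction φ generalizing T with
  | atom p => rfl
  | natom p => rfl
  | conj φ ψ ih₁ ih₂ =>
    simp only [laxSat, traceSat, ih₁ hφ.1, ih₂ hφ.2, ← forall₂_and]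
  | disj φ ψ ih₁ ih₂ =>
    simp only [laxSat, traceSat, ih₁ hφ.1, ih₂ hφ.2]
    constructor
    · rintro ⟨T₁, T₂, rfl, h₁, h₂⟩ t (ht | ht)
      exacts [.inl (h₁ t ht), .inr (h₂ t ht)]
    · intro h
      refine ⟨{t ∈ T | traceSat φ t}, {t ∈ T | traceSat ψ t}, ?_,
        fun _ ht => ht.2, fun _ ht => ht.2⟩
      rw [← Set.sep_or]
      exact (Set.sep_eq_self_iff_mem_true.2 h).symm
  | next φ ih =>
    simp only [laxSat, traceSat, ih hφ]
    constructor
    · exact fun h t ht => h _ ⟨t, ht, 1, rfl, rfl⟩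
    · rintro h _ ⟨t, ht, _, rfl, rfl⟩
      exact h t ht
  | glob φ ih =>
    simp only [laxSat, traceSat, ih hφ]
    constructor
    · exact fun h t ht i => h (fun _ => {i}) (fun _ _ => ⟨i, rfl⟩) _ ⟨t, ht, i, rfl, rfl⟩
    · rintro h f - _ ⟨t, ht, i, -, rfl⟩
      exact h t ht i
  | untl φ ψ ih₁ ih₂ =>
    rw [laxSat_untl_iff (ih₁ hφ.1)]
    simp only [traceSat, ih₂ hφ.2]
    constructor
    · rintro ⟨f, hf, hψ, h⟩ t ht
      obtain ⟨n, hn⟩ := hf t ht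
      exact ⟨n, hψ _ ⟨t, ht, n, hn, rfl⟩, h t ht n hn⟩
    · intro h
      choose! f hψ h using h
      refine ⟨fun t => {f t}, fun t _ => ⟨f t, rfl⟩, ?_, ?_⟩
      · rintro _ ⟨t, ht, _, rfl, rfl⟩
        exact hψ t ht
      · rintro t ht _ rfl
        exact h t ht
  | bor => exact hφ.elim
  | bneg => exact hφ.elim

/-- LTL-formulae are flat under strict team semantics. -/
theorem strictSat_iff_of_isLTL (φ : Formula AP) (hφ : φ.isLTL) (T : MultiTeam ι AP) :
    strictSat φ T ↔ ∀ x ∈ T, traceSat φ x.2 := by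
  induction φ generalizing T with
  | atom p => rfl
  | natom p => rfl
  | conj φ ψ ih₁ ih₂ =>
    simp only [strictSat, traceSat, ih₁ hφ.1, ih₂ hφ.2, ← forall₂_and]
  | disj φ ψ ih₁ ih₂ =>
    simp only [strictSat, traceSat, ih₁ hφ.1, ih₂ hφ.2]
    constructor
    · rintro ⟨T₁, T₂, rfl, -, h₁, h₂⟩ x (hx | hx)
      exacts [.inl (h₁ x hx), .inr (h₂ x hx)]
    · intro h
      exact ⟨T ∩ {x | traceSat φ x.2}, T \ {x | traceSat φ x.2},
        (Set.inter_union_sdiff _ _).symm, (Set.disjoint_sdiff_inter.symm).inter_eq,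
        fun _ hx => hx.2, fun x hx => (h x hx.1).resolve_left hx.2⟩
  | next φ ih =>
    simp only [strictSat, traceSat, ih hφ]
    constructor
    · exact fun h x hx => h _ ⟨x, hx, rfl⟩
    · rintro h _ ⟨x, hx, rfl⟩
      exact h x hx
  | glob φ ih =>
    simp only [strictSat, traceSat, ih hφ]
    constructor
    · exact fun h x hx i => h (fun _ => i) _ ⟨x, hx, rfl⟩
    · rintro h f _ ⟨x, hx, rfl⟩
      exact h x hx _
  | untl φ ψ ih₁ ih₂ =>
    rw [strictSat_untl_iff (ih₁ hφ.1)]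
    simp only [traceSat, ih₂ hφ.2]
    constructor
    · rintro ⟨f, hψ, h⟩ x hx
      exact ⟨f x, hψ _ ⟨x, hx, rfl⟩, h x hx⟩
    · intro h
      choose! f hψ h using h
      refine ⟨f, ?_, h⟩
      rintro _ ⟨x, hx, rfl⟩
      exact hψ x hx
  | bor => exact hφ.elim
  | bneg => exact hφ.elim

theorem Team.update_mono_s8 {T T' : Team AP} (h : T' ⊆ T) (f : Trace AP → Set ℕ) :
    T'.update f ⊆ T.update f := by
  rintro _ ⟨t, ht, i, hi, rfl⟩
  exact ⟨t, h ht, i, hi, rfl⟩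

/-- Left-flat formulae are downward closed under lax team semantics. -/
theorem laxSat_mono_of_leftFlat (φ : Formula AP) (hφ : φ.leftFlat) {T T' : Team AP}
    (hT : T' ⊆ T) (h : laxSat φ T) : laxSat φ T' := by
  induction φ generalizing T T' with
  | atom p => exact fun t ht => h t (hT ht)
  | natom p => exact fun t ht => h t (hT ht)
  | conj φ ψ ih₁ ih₂ => exact ⟨ih₁ hφ.1 hT h.1, ih₂ hφ.2 hT h.2⟩
  | disj φ ψ ih₁ ih₂ =>
    obtain ⟨T₁, T₂, rfl, h₁, h₂⟩ := h
    refine ⟨T' ∩ T₁, T' ∩ T₂, ?_, ih₁ hφ.1 Set.inter_subset_right h₁,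
      ih₂ hφ.2 Set.inter_subset_right h₂⟩
    rw [← Set.inter_union_distrib_left, Set.inter_eq_left.2 hT]
  | next φ ih => exact ih hφ (Team.update_mono_s8 hT _) h
  | glob φ =>
    rw [laxSat_iff_of_isLTL (.glob φ) hφ] at h ⊢
    exact fun t ht => h t (hT ht)
  | untl φ ψ _ ih =>
    rw [laxSat_untl_iff (laxSat_iff_of_isLTL φ hφ.1)] at h ⊢
    obtain ⟨f, hf, hψ, h⟩ := h
    exact ⟨f, fun t ht => hf t (hT ht), ih hφ.2 (Team.update_mono_s8 hT f) hψ,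
      fun t ht => h t (hT ht)⟩
  | bor φ ψ ih₁ ih₂ => exact h.imp (ih₁ hφ.1 hT) (ih₂ hφ.2 hT)
  | bneg => exact hφ.elim

theorem MultiTeam.support_update (T : MultiTeam ι AP) (f : ι × Trace AP → ℕ) :
    (T.update f).support = Team.update T.support fun t => {n | ∃ i, (i, t) ∈ T ∧ f (i, t) = n} := by
  ext s
  constructor
  · rintro ⟨_, ⟨i, t⟩, h, ⟨⟩⟩
    exact ⟨t, ⟨i, h⟩, f (i, t), ⟨i, h, rfl⟩, rfl⟩
  · rintro ⟨t, -, _, ⟨i, h, rfl⟩, rfl⟩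
    exact ⟨i, (i, t), h, rfl⟩

theorem MultiTeam.support_update_comp_snd (T : MultiTeam ι AP) (f : Trace AP → ℕ) :
    (T.update fun x => f x.2).support = Team.update T.support fun t => {f t} := by
  ext s
  constructor
  · rintro ⟨_, ⟨i, t⟩, h, ⟨⟩⟩
    exact ⟨t, ⟨i, h⟩, f t, rfl, rfl⟩
  · rintro ⟨t, ⟨i, h⟩, _, rfl, rfl⟩
    exact ⟨i, (i, t), h, rfl⟩

theorem MultiTeam.support_union (T₁ T₂ : MultiTeam ι AP) :
    MultiTeam.support (T₁ ∪ T₂) = T₁.support ∪ T₂.support :=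
  Set.ext fun _ => exists_or

end Flatness

/-- Strict and lax semantics agree on left-flat TeamLTL(⊽)-formulae: for every
multiteam `T`, `T ⊨ φ` strictly iff `support(T) ⊨ˡ φ`. -/
theorem strict_eq_lax_on_leftFlat {AP : Type} (φ : Formula AP) (hφ : φ.leftFlat)
    (ι : Type) (T : MultiTeam ι AP) :
    strictSat φ T ↔ laxSat φ (MultiTeam.support T) := by
  induction φ generalizing T with
  | atom p => exact ⟨fun h t ⟨i, hi⟩ => h (i, t) hi, fun h x hx => h x.2 ⟨x.1, hx⟩⟩
  | natom p => exact ⟨fun h t ⟨i, hi⟩ => h (i, t) hi, fun h x hx => h x.2 ⟨x.1, hx⟩⟩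
  | conj φ ψ ih₁ ih₂ => exact and_congr (ih₁ hφ.1 T) (ih₂ hφ.2 T)
  | disj φ ψ ih₁ ih₂ =>
    simp only [strictSat, laxSat, ih₁ hφ.1, ih₂ hφ.2]
    constructor
    · rintro ⟨T₁, T₂, rfl, -, h₁, h₂⟩
      exact ⟨_, _, MultiTeam.support_union T₁ T₂, h₁, h₂⟩
    · rintro ⟨A, B, hAB, hA, hB⟩
      refine ⟨T ∩ {x | x.2 ∈ A}, T \ {x | x.2 ∈ A}, (Set.inter_union_sdiff _ _).symm,
        (Set.disjoint_sdiff_inter.symm).inter_eq, laxSat_mono_of_leftFlat φ hφ.1 ?_ hA,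
        laxSat_mono_of_leftFlat ψ hφ.2 ?_ hB⟩
      · rintro t ⟨i, -, ht⟩
        exact ht
      · rintro t ⟨i, hi, ht⟩
        have : t ∈ A ∪ B := hAB ▸ ⟨i, hi⟩
        exact this.resolve_left ht
  | next φ ih =>
    simp only [strictSat, laxSat, ih hφ]
    rw [MultiTeam.support_update_comp_snd T fun _ => 1]
  | glob φ =>
    rw [strictSat_iff_of_isLTL (.glob φ) hφ, laxSat_iff_of_isLTL (.glob φ) hφ]
    exact ⟨fun h t ⟨i, hi⟩ => h (i, t) hi, fun h x hx => h x.2 ⟨x.1, hx⟩⟩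
  | untl φ ψ _ ih =>
    rw [strictSat_untl_iff (strictSat_iff_of_isLTL φ hφ.1),
      laxSat_untl_iff (laxSat_iff_of_isLTL φ hφ.1)]
    simp only [ih hφ.2]
    constructor
    · rintro ⟨f, hψ, h⟩
      rw [MultiTeam.support_update] at hψ
      refine ⟨_, ?_, hψ, ?_⟩
      · rintro t ⟨i, hi⟩
        exact ⟨f (i, t), i, hi, rfl⟩
      rintro t - _ ⟨i, hi, rfl⟩
      exact h (i, t) hi
    · rintro ⟨f, hf, hψ, h⟩
      refine ⟨fun x => sInf (f x.2), laxSat_mono_of_leftFlat ψ hφ.2 ?_ hψ, fun x hx =>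
        h x.2 ⟨x.1, hx⟩ _ (Nat.sInf_mem (hf x.2 ⟨x.1, hx⟩))⟩
      rw [MultiTeam.support_update_comp_snd T fun t => sInf (f t)]
      rintro _ ⟨t, ht, _, rfl, rfl⟩
      exact ⟨t, ht, _, Nat.sInf_mem (hf t ht), rfl⟩
  | bor φ ψ ih₁ ih₂ => exact or_congr (ih₁ hφ.1 T) (ih₂ hφ.2 T)
  | bneg => exact hφ.elim

end TeamLTL
end

section
/- G distributes over Boolean disjunctions of LTL-formulae in lax semantics: let α₁, …, αₙ be LTL-formulae (⊽-free TeamLTL-formulae). For every team T: T ⊨ˡ G(α₁ ⊽ ⋯ ⊽ αₙ) if and only if T ⊨ˡ Gα₁ ⊽ ⋯ ⊽ Gαₙ. -/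
namespace TeamLTL

open Classical in
/-- Lax satisfaction of `∼`-free formulae is downward closed. -/
theorem laxSat.mono {AP : Type} {φ : Formula AP} (hφ : φ.noBneg) {S T : Team AP}
    (hST : S ⊆ T) (h : laxSat φ T) : laxSat φ S := by
  induction φ generalizing S T with
  | atom p => exact fun t ht => h t (hST ht)
  | natom p => exact fun t ht => h t (hST ht)
  | conj φ ψ ihφ ihψ => exact ⟨ihφ hφ.1 hST h.1, ihψ hφ.2 hST h.2⟩
  | disj φ ψ ihφ ihψ =>
    obtain ⟨T₁, T₂, rfl, h₁, h₂⟩ := h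
    refine ⟨S ∩ T₁, S ∩ T₂, ?_, ihφ hφ.1 Set.inter_subset_right h₁,
      ihψ hφ.2 Set.inter_subset_right h₂⟩
    rw [← Set.inter_union_distrib_left, Set.inter_eq_left.2 hST]
  | next φ ih => exact ih hφ (Team.update_mono hST fun _ _ => subset_rfl) h
  | glob φ ih =>
    intro f hf
    refine ih hφ (Team.update_mono hST fun t ht => ?_)
      (h (fun t => if t ∈ S then f t else {0}) fun t _ => ?_)
    · simp [ht]
    · by_cases ht : t ∈ S
      · simpa [ht] using hf t ht
      · simp [ht]
  | untl φ ψ ihφ ihψ =>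
    obtain ⟨f, hf, hψ, hU⟩ := h
    refine ⟨f, fun t ht => hf t (hST ht),
      ihψ hφ.2 (Team.update_mono hST fun _ _ => subset_rfl) hψ, ?_⟩
    have hsub : {t ∈ S | f t ≠ ({0} : Set ℕ)} ⊆ {t ∈ T | f t ≠ ({0} : Set ℕ)} :=
      fun t ht => ⟨hST ht.1, ht.2⟩
    rcases hU with hU | hU
    · exact .inl (Set.subset_eq_empty hsub hU)
    refine .inr fun f' hf' hlt => ihφ hφ.1 (Team.update_mono hsub fun t ht => ?_)
      (hU (fun t => if t ∈ S then f' t else {0}) (fun t ht => ?_) fun t ht => ?_)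
    · simp [ht.1]
    · by_cases htS : t ∈ S
      · simpa [htS] using hf' t ⟨htS, ht.2⟩
      · simp [htS]
    · by_cases htS : t ∈ S
      · simpa [htS] using hlt t ⟨htS, ht.2⟩
      · simp only [htS, if_false, csInf_singleton, zero_le, true_and]
        refine fun m hm => ⟨0, isGreatest_singleton, Nat.pos_of_ne_zero fun h0 => ht.2 ?_⟩
        subst h0
        exact (hf t ht.1).subset_singleton_iff.1 fun i hi => Nat.le_zero.1 (hm.2 hi)
  | bor φ ψ ihφ ihψ => exact h.imp (ihφ hφ.1 hST) (ihψ hφ.2 hST)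
  | bneg φ => exact hφ.elim

theorem Formula.isLTL.noBneg {AP : Type} {φ : Formula AP} (h : φ.isLTL) : φ.noBneg := by
  induction φ <;> simp_all [Formula.isLTL, Formula.noBneg]

theorem laxSat_disjOf {AP : Type} (a : Formula AP) (l : List (Formula AP)) (T : Team AP) :
    laxSat (disjOf a l) T ↔ ∃ β ∈ a :: l, laxSat β T := by
  induction l generalizing a with
  | nil => simp [disjOf]
  | cons b l ih => simp [disjOf, laxSat, ih]

/-- For `∼`-free `φ`, the pointwise largest `f` is the only one to be checked for `G φ`. -/
theorem laxSat_glob_iff_update_univ {AP : Type} {φ : Formula AP} (hφ : φ.noBneg) {T : Team AP} :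
    laxSat (.glob φ) T ↔ laxSat φ (Team.update T fun _ => Set.univ) :=
  ⟨fun h => h _ fun _ _ => Set.univ_nonempty,
    fun h _ _ => h.mono hφ (Team.update_mono subset_rfl fun _ _ => Set.subset_univ _)⟩

/-- `G` distributes over Boolean disjunctions of LTL-formulae in lax semantics:
`T ⊨ˡ G(α₁ ⊽ ⋯ ⊽ αₙ)` iff `T ⊨ˡ Gα₁ ⊽ ⋯ ⊽ Gαₙ`. -/
theorem glob_distributes_over_bor {AP : Type} (α : Formula AP)
    (αs : List (Formula AP)) (h : ∀ β ∈ α :: αs, β.isLTL) (T : Team AP) :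
    laxSat (Formula.glob (disjOf α αs)) T ↔
      laxSat (disjOf (Formula.glob α) (αs.map Formula.glob)) T := by
  simp only [laxSat_disjOf, ← List.map_cons, List.mem_map, exists_exists_and_eq_and]
  constructor
  · intro hG
    obtain ⟨β, hβ, hsat⟩ := (laxSat_disjOf ..).1 (hG _ fun _ _ => Set.univ_nonempty)
    exact ⟨β, hβ, (laxSat_glob_iff_update_univ (h β hβ).noBneg).2 hsat⟩
  · rintro ⟨β, hβ, hsat⟩ f hf
    exact (laxSat_disjOf ..).2 ⟨β, hβ, hsat f hf⟩

end TeamLTL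
end
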